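/- arXiv:1805.08114 — 3 statements merged into one kernel-verified Lean document; each statement's English description precedes it below -/
import Mathlib

section
/- Let f : ℝ^d → ℝ be M-smooth, L-Lipschitz, and bounded from below. Consider SGD iterates x_{t+1} = x_t − η_t g_t, where g_t = g(x_t, ξ_t) are stochastic gradients satisfying E_t[g_t] = ∇f(x_t) (conditionally on ξ_1,…,ξ_{t−1}) and bounded noise ‖g_t − ∇f(x_t)‖ ≤ S almost surely, and where the stepsizes are the global generalized AdaGrad stepsizes η_t = α / (β + Σ_{i=1}^{t−1} ‖g_i‖²)^{1/2+ε} with α, β > 0 and ε ∈ (0, 1/2]. Then ‖∇f(x_t)‖ converges to 0 almost surely as t → ∞. -/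
open MeasureTheory Filter Real

/-- One step of the telescoping estimate for AdaGrad-type series: it compares a term with the
increment of the convex function `s ↦ s ^ (-r)`. -/
lemma div_rpow_one_add_le {s q β Q r : ℝ} (hβ : 0 < β) (hr : 0 < r) (hs : β ≤ s)
    (hq : 0 ≤ q) (hqQ : q ≤ Q) :
    q / s ^ (1 + r) ≤ (1 + Q / β) ^ (1 + r) / r * (s ^ (-r) - (s + q) ^ (-r)) := by
  have hs0 : 0 < s := hβ.trans_le hs
  have hu0 : 0 < s + q := by linarith
  have hQ : 0 ≤ Q := hq.trans hqQ
  have hquot : (s + q) ≤ (1 + Q / β) * s := by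
    have : Q ≤ Q / β * s := by
      rw [div_mul_eq_mul_div, le_div_iff₀ hβ]
      exact mul_le_mul_of_nonneg_left hs hQ
    linarith
  have htangent : r * q / (s + q) ^ (1 + r) ≤ s ^ (-r) - (s + q) ^ (-r) := by
    have hratio : 1 + r * (q / (s + q)) ≤ (s / (s + q)) ^ (-r) := by
      rw [Real.rpow_def_of_pos (by positivity)]
      have hlog : Real.log (s / (s + q)) ≤ s / (s + q) - 1 :=
        Real.log_le_sub_one_of_pos (by positivity)
      have hfrac : s / (s + q) - 1 = -(q / (s + q)) := by field_simp; ring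
      have hexp := Real.add_one_le_exp (Real.log (s / (s + q)) * -r)
      nlinarith
    have hpos : 0 < (s + q) ^ (-r) := by positivity
    rw [Real.div_rpow hs0.le hu0.le, le_div_iff₀ hpos] at hratio
    have hpow : r * q / (s + q) ^ (1 + r) = r * (q / (s + q)) * (s + q) ^ (-r) := by
      rw [Real.rpow_add hu0, Real.rpow_one, Real.rpow_neg hu0.le]
      field_simp
    rw [hpow]
    linarith
  have hpow_le : (s + q) ^ (1 + r) ≤ (1 + Q / β) ^ (1 + r) * s ^ (1 + r) := by
    rw [← Real.mul_rpow (by positivity) hs0.le]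
    exact Real.rpow_le_rpow hu0.le hquot (by linarith)
  have hstep : q / s ^ (1 + r) ≤ (1 + Q / β) ^ (1 + r) * (q / (s + q) ^ (1 + r)) := by
    rw [← mul_div_assoc, div_le_div_iff₀ (by positivity) (by positivity)]
    nlinarith [mul_le_mul_of_nonneg_left hpow_le hq]
  calc q / s ^ (1 + r) ≤ (1 + Q / β) ^ (1 + r) * (q / (s + q) ^ (1 + r)) := hstep
    _ = (1 + Q / β) ^ (1 + r) / r * (r * q / (s + q) ^ (1 + r)) := by field_simp
    _ ≤ _ := by gcongr

lemma sum_div_rpow_one_add_le {q : ℕ → ℝ} {β Q r : ℝ} (hβ : 0 < β) (hr : 0 < r)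
    (hq : ∀ t, 0 ≤ q t) (hqQ : ∀ t, q t ≤ Q) (T : ℕ) :
    ∑ t ∈ Finset.range T, q t / (β + ∑ i ∈ Finset.range t, q i) ^ (1 + r) ≤
      (1 + Q / β) ^ (1 + r) / r * β ^ (-r) := by
  have hQ : 0 ≤ Q := (hq 0).trans (hqQ 0)
  have hs : ∀ t, β ≤ β + ∑ i ∈ Finset.range t, q i := fun t ↦
    le_add_of_nonneg_right (Finset.sum_nonneg fun i _ ↦ hq i)
  have hlast : 0 ≤ (β + ∑ i ∈ Finset.range T, q i) ^ (-r) :=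
    Real.rpow_nonneg (hβ.le.trans (hs T)) _
  calc _ ≤ ∑ t ∈ Finset.range T, (1 + Q / β) ^ (1 + r) / r *
        ((β + ∑ i ∈ Finset.range t, q i) ^ (-r) -
          (β + ∑ i ∈ Finset.range (t + 1), q i) ^ (-r)) := by
        refine Finset.sum_le_sum fun t _ ↦ ?_
        rw [Finset.sum_range_succ, ← add_assoc]
        exact div_rpow_one_add_le hβ hr (hs t) (hq t) (hqQ t)
    _ = (1 + Q / β) ^ (1 + r) / r * (β ^ (-r) - (β + ∑ i ∈ Finset.range T, q i) ^ (-r)) := by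
        rw [← Finset.mul_sum, Finset.sum_range_sub']
        simp
    _ ≤ _ := by
        gcongr
        linarith

lemma not_summable_div_rpow_sum {q : ℕ → ℝ} {α β Q p : ℝ} (hα : 0 < α) (hβ : 0 < β)
    (hp : 0 ≤ p) (hp1 : p ≤ 1) (hq : ∀ t, 0 ≤ q t) (hqQ : ∀ t, q t ≤ Q) :
    ¬ Summable fun t ↦ α / (β + ∑ i ∈ Finset.range t, q i) ^ p := by
  have hQ : 0 ≤ Q := (hq 0).trans (hqQ 0)
  have hc : 0 < β + Q + 1 := by positivity
  intro hsum
  have hharm : Summable fun t : ℕ ↦ α / (β + Q + 1) * (1 / ((t : ℝ) + 1)) := by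
    refine hsum.of_nonneg_of_le (fun t ↦ by positivity) fun t ↦ ?_
    have hnonneg : 0 ≤ ∑ i ∈ Finset.range t, q i := Finset.sum_nonneg fun i _ ↦ hq i
    have hle : ∑ i ∈ Finset.range t, q i ≤ t * Q := by
      simpa using Finset.sum_le_card_nsmul (Finset.range t) q Q fun i _ ↦ hqQ i
    have ht : (0 : ℝ) ≤ t := t.cast_nonneg
    have hbase : β + ∑ i ∈ Finset.range t, q i ≤ (β + Q + 1) * (t + 1) := by
      nlinarith [mul_nonneg hβ.le ht]
    have hone : 1 ≤ (β + Q + 1) * ((t : ℝ) + 1) := by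
      nlinarith [mul_nonneg (add_nonneg hβ.le hQ) ht]
    have hpow : (β + ∑ i ∈ Finset.range t, q i) ^ p ≤ (β + Q + 1) * (t + 1) :=
      (Real.rpow_le_rpow (by positivity) hbase hp).trans
        ((Real.rpow_le_rpow_of_exponent_le hone hp1).trans_eq (Real.rpow_one _))
    rw [div_mul_div_comm, mul_one]
    have : 0 < (β + ∑ i ∈ Finset.range t, q i) ^ p := by positivity
    gcongr
  refine Real.not_summable_one_div_natCast ((summable_nat_add_iff 1).1 ?_)
  simpa using (summable_mul_left_iff (by positivity)).1 hharm

/-- A bounded nonnegative sequence which is square summable against non-summable weights `η`, with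
square summable increments of size `O(η)`, tends to zero. -/
lemma tendsto_zero_of_summable_mul_sq {a w η : ℕ → ℝ} {A K : ℝ} (ha : ∀ t, 0 ≤ a t)
    (haA : ∀ t, a t ≤ A) (hη : ∀ t, 0 ≤ η t) (hinc : ∀ t, |a (t + 1) - a t| ≤ w t)
    (hwK : ∀ t, w t ≤ K * η t) (hsum : Summable fun t ↦ η t * a t ^ 2)
    (hw : Summable fun t ↦ w t ^ 2) (hη_sum : ¬ Summable η) :
    Tendsto a atTop (nhds 0) := by
  have hA : 0 ≤ A := (ha 0).trans (haA 0)
  have hcube : CauchySeq fun t ↦ a t ^ 3 := by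
    refine cauchySeq_of_summable_dist (Summable.of_nonneg_of_le (fun _ ↦ dist_nonneg) (fun t ↦ ?_)
      ((hsum.mul_left (3 * K)).add (hw.mul_left (4 * A))))
    have hδA : |a (t + 1) - a t| ≤ A :=
      abs_sub_le_of_nonneg_of_le (ha _) (haA _) (ha _) (haA _)
    have hsq : (a (t + 1) - a t) ^ 2 ≤ w t ^ 2 :=
      sq_le_sq' (abs_le.1 (hinc t)).1 (abs_le.1 (hinc t)).2
    have hfirst : 3 * a t ^ 2 * |a (t + 1) - a t| ≤ 3 * K * (η t * a t ^ 2) := by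
      nlinarith [mul_le_mul_of_nonneg_left ((hinc t).trans (hwK t)) (sq_nonneg (a t))]
    have hrest : (3 * a t + |a (t + 1) - a t|) * (a (t + 1) - a t) ^ 2 ≤ 4 * A * w t ^ 2 := by
      have := haA t
      have := ha t
      gcongr
      linarith
    rw [dist_comm, Real.dist_eq]
    have hexpand : a (t + 1) ^ 3 - a t ^ 3 = 3 * a t ^ 2 * (a (t + 1) - a t) +
        3 * a t * (a (t + 1) - a t) ^ 2 + (a (t + 1) - a t) * (a (t + 1) - a t) ^ 2 := by ring
    rw [hexpand]
    refine (abs_add_three _ _ _).trans ?_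
    rw [abs_mul, abs_mul (3 * a t), abs_mul (_ - _), abs_of_nonneg (sq_nonneg (a (t + 1) - a t)),
      abs_of_nonneg (by positivity : 0 ≤ 3 * a t ^ 2),
      abs_of_nonneg (by linarith [ha t] : 0 ≤ 3 * a t)]
    linarith
  obtain ⟨l, hl⟩ := cauchySeq_tendsto_of_complete hcube
  have hlim : Tendsto a atTop (nhds (l ^ (1 / 3 : ℝ))) := by
    refine (hl.rpow_const (Or.inr (by norm_num))).congr fun t ↦ ?_
    rw [← Real.rpow_natCast, ← Real.rpow_mul (ha t)]
    norm_num
  have hl0 : l ^ (1 / 3 : ℝ) = 0 := by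
    by_contra hne
    have hpos : 0 < (l ^ (1 / 3 : ℝ)) ^ 2 := by positivity
    refine hη_sum (.of_norm_bounded_eventually_nat
      (hsum.mul_left (2 / (l ^ (1 / 3 : ℝ)) ^ 2)) ?_)
    filter_upwards [(hlim.pow 2).eventually_const_le (half_lt_self hpos)] with t ht
    rw [Real.norm_of_nonneg (hη t), div_mul_eq_mul_div, le_div_iff₀ hpos]
    nlinarith [mul_le_mul_of_nonneg_left ht (hη t)]
  rwa [hl0] at hlim

section Gradient

variable {E : Type*} [NormedAddCommGroup E] [InnerProductSpace ℝ E] [CompleteSpace E] {f : E → ℝ}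

lemma le_add_inner_gradient_of_gradient_lipschitz {K : ℝ} (hK : 0 ≤ K) (hf : Differentiable ℝ f)
    (hsmooth : ∀ y z, ‖gradient f y - gradient f z‖ ≤ K * ‖y - z‖) (y z : E) :
    f z ≤ f y + inner ℝ (gradient f y) (z - y) + K * ‖z - y‖ ^ 2 := by
  have hbound : ∀ u ∈ segment ℝ y z, ‖fderiv ℝ f u - fderiv ℝ f y‖ ≤ K * ‖z - y‖ := by
    intro u hu
    rw [← toDual_gradient, ← toDual_gradient, ← map_sub, LinearIsometryEquiv.norm_map]
    refine (hsmooth u y).trans (mul_le_mul_of_nonneg_left ?_ hK)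
    exact norm_sub_le_of_mem_segment hu
  have h := (convex_segment y z).norm_image_sub_le_of_norm_fderiv_le' (fun u _ ↦ hf u) hbound
    (left_mem_segment ℝ y z) (right_mem_segment ℝ y z)
  rw [← toDual_gradient, InnerProductSpace.toDual_apply_apply] at h
  have := (abs_le.1 (Real.norm_eq_abs _ ▸ h)).2
  linarith

lemma norm_gradient_le_of_lipschitz {K : ℝ} (hK : 0 ≤ K)
    (hlip : ∀ y z, |f y - f z| ≤ K * ‖y - z‖) (y : E) : ‖gradient f y‖ ≤ K := by
  rw [gradient, LinearIsometryEquiv.norm_map]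
  exact norm_fderiv_le_of_lip' ℝ hK (Eventually.of_forall fun z ↦ hlip z y)

end Gradient

/-- Nonnegative functions whose partial sums have uniformly bounded integrals are almost everywhere
summable. -/
lemma ae_summable_of_integral_sum_le {Ω : Type*} {m0 : MeasurableSpace Ω} {μ : Measure Ω}
    {h : ℕ → Ω → ℝ} {C : ℝ} (hint : ∀ t, Integrable (h t) μ) (hnonneg : ∀ t ω, 0 ≤ h t ω)
    (hC : ∀ T, ∑ t ∈ Finset.range T, ∫ ω, h t ω ∂μ ≤ C) :
    ∀ᵐ ω ∂μ, Summable fun t ↦ h t ω := by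
  have hmeas : ∀ t, AEMeasurable (fun ω ↦ ENNReal.ofReal (h t ω)) μ := fun t ↦
    (hint t).aemeasurable.ennreal_ofReal
  have hfin : ∫⁻ ω, ∑' t, ENNReal.ofReal (h t ω) ∂μ ≠ ⊤ := by
    rw [lintegral_tsum hmeas]
    have hsum : Summable fun t ↦ ∫ ω, h t ω ∂μ :=
      summable_of_sum_range_le (fun t ↦ integral_nonneg (hnonneg t)) hC
    simp_rw [← fun t ↦ ofReal_integral_eq_lintegral_ofReal (hint t) (ae_of_all _ (hnonneg t))]
    exact hsum.tsum_ofReal_ne_top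
  filter_upwards [ae_lt_top' (AEMeasurable.tsum hmeas) hfin] with ω hω
  refine (ENNReal.summable_toReal hω.ne).congr fun t ↦ ?_
  exact ENNReal.toReal_ofReal (hnonneg t ω)

/-- Testing an integrable `g` against a bounded `m`-measurable vector `Y` only sees the conditional
expectation of `g`. -/
lemma integral_inner_eq_of_condExp_ae_eq {E Ω : Type*} [NormedAddCommGroup E]
    [InnerProductSpace ℝ E] [CompleteSpace E] {m m0 : MeasurableSpace Ω} {μ : Measure Ω}
    [IsProbabilityMeasure μ] (hm : m ≤ m0) {Y g h : Ω → E} {c : ℝ}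
    (hY : StronglyMeasurable[m] Y) (hYc : ∀ ω, ‖Y ω‖ ≤ c) (hg : Integrable g μ)
    (hgh : μ[g | m] =ᵐ[μ] h) :
    ∫ ω, inner ℝ (Y ω) (g ω) ∂μ = ∫ ω, inner ℝ (Y ω) (h ω) ∂μ := by
  rw [← integral_condExp hm]
  refine integral_congr_ae ((condExp_stronglyMeasurable_bilin_of_bound (innerSL ℝ) hm hY hg c
    (ae_of_all _ hYc)).trans ?_)
  filter_upwards [hgh] with ω hω
  rw [hω]
  rfl

/-- Almost sure convergence to zero of the gradients of SGD with the
global generalized AdaGrad stepsizes, for an `M`-smooth, `L`-Lipschitz function bounded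
from below, with unbiased stochastic gradients whose noise has support bounded by `S`. -/
theorem sgd_global_adagrad_gradient_tendsto_zero_ae
    {d : ℕ} {Ω : Type*} {m0 : MeasurableSpace Ω} {μ : Measure Ω}
    [IsProbabilityMeasure μ] (ℱ : Filtration ℕ m0)
    (f : EuclideanSpace ℝ (Fin d) → ℝ) (M L S α β ε : ℝ)
    (hf_diff : Differentiable ℝ f)
    (hf_smooth : ∀ y z, ‖gradient f y - gradient f z‖ ≤ M * ‖y - z‖)
    (hf_lip : ∀ y z, |f y - f z| ≤ L * ‖y - z‖)
    (hf_bdd : BddBelow (Set.range f))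
    (hα : 0 < α) (hβ : 0 < β) (hε : 0 < ε) (hε' : ε ≤ 1 / 2)
    (x g : ℕ → Ω → EuclideanSpace ℝ (Fin d)) (η : ℕ → Ω → ℝ)
    (x₁ : EuclideanSpace ℝ (Fin d))
    (hx0 : ∀ ω, x 0 ω = x₁)
    (hg_meas : ∀ t, StronglyMeasurable[ℱ (t + 1)] (g t))
    (hg_int : ∀ t, Integrable (g t) μ)
    (hg_cond : ∀ t, μ[g t | ℱ t] =ᵐ[μ] fun ω => gradient f (x t ω))
    (hnoise : ∀ᵐ ω ∂μ, ∀ t, ‖g t ω - gradient f (x t ω)‖ ≤ S)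
    (hη : ∀ t ω, η t ω =
      α / (β + ∑ i ∈ Finset.range t, ‖g i ω‖ ^ 2) ^ ((1 : ℝ) / 2 + ε))
    (hupd : ∀ t ω, x (t + 1) ω = x t ω - η t ω • g t ω) :
    ∀ᵐ ω ∂μ, Tendsto (fun t => ‖gradient f (x t ω)‖) atTop (nhds 0) := by
  have hL0 := abs_nonneg L
  have hM0 := abs_nonneg M
  have hlip : ∀ y z, |f y - f z| ≤ |L| * ‖y - z‖ := fun y z ↦
    (hf_lip y z).trans (mul_le_mul_of_nonneg_right (le_abs_self L) (norm_nonneg _))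
  have hsmooth : ∀ y z, ‖gradient f y - gradient f z‖ ≤ |M| * ‖y - z‖ := fun y z ↦
    (hf_smooth y z).trans (mul_le_mul_of_nonneg_right (le_abs_self M) (norm_nonneg _))
  have hgrad : ∀ y, ‖gradient f y‖ ≤ |L| := norm_gradient_le_of_lipschitz hL0 hlip
  have hgrad_cont : Continuous (gradient f) :=
    (LipschitzWith.of_dist_le_mul (K := ⟨|M|, hM0⟩) fun y z ↦ by
      rw [dist_eq_norm, dist_eq_norm]
      exact hsmooth y z).continuous
  set G := |L| + |S|
  have hG0 : 0 ≤ G := by positivity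
  set p := (1 : ℝ) / 2 + ε
  set H := α / β ^ p
  have hη_pos : ∀ t ω, 0 < η t ω := fun t ω ↦ by rw [hη]; positivity
  have hη_le : ∀ t ω, η t ω ≤ H := fun t ω ↦ by
    have : 0 ≤ ∑ i ∈ Finset.range t, ‖g i ω‖ ^ 2 := by positivity
    rw [hη]
    simp only [H, p]
    gcongr
    linarith
  have hη_meas : ∀ t, StronglyMeasurable[ℱ t] (η t) := fun t ↦ by
    have hsum : Measurable[ℱ t] fun ω ↦ ∑ i ∈ Finset.range t, ‖g i ω‖ ^ 2 :=
      Finset.measurable_sum _ fun i hi ↦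
        (((hg_meas i).mono (ℱ.mono (Finset.mem_range.1 hi))).norm.measurable.pow_const 2)
    rw [funext (hη t)]
    exact (((hsum.const_add β).pow_const _).const_div α).stronglyMeasurable
  have hx_meas : ∀ t, StronglyMeasurable[ℱ t] (x t) := by
    intro t
    induction t with
    | zero => rw [funext hx0]; exact stronglyMeasurable_const
    | succ t ih =>
      rw [funext (hupd t)]
      exact (ih.mono (ℱ.mono t.le_succ)).sub
        (((hη_meas t).mono (ℱ.mono t.le_succ)).smul (hg_meas t))
  have hY_meas : ∀ t, StronglyMeasurable[ℱ t] fun ω ↦ η t ω • gradient f (x t ω) := fun t ↦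
    (hη_meas t).smul (hgrad_cont.comp_stronglyMeasurable (hx_meas t))
  have hY_le : ∀ t ω, ‖η t ω • gradient f (x t ω)‖ ≤ H * |L| := fun t ω ↦ by
    rw [norm_smul, Real.norm_of_nonneg (hη_pos t ω).le]
    exact mul_le_mul (hη_le t ω) (hgrad _) (norm_nonneg _) ((hη_pos t ω).le.trans (hη_le t ω))
  have hg_le : ∀ᵐ ω ∂μ, ∀ t, ‖g t ω‖ ≤ G := by
    filter_upwards [hnoise] with ω hω t
    calc ‖g t ω‖ = ‖gradient f (x t ω) + (g t ω - gradient f (x t ω))‖ := by simp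
      _ ≤ _ := norm_add_le_of_le (hgrad _) ((hω t).trans (le_abs_self S))
  set B := α ^ 2 * ((1 + G ^ 2 / β) ^ (1 + 2 * ε) / (2 * ε) * β ^ (-(2 * ε)))
  have hstep_sum : ∀ᵐ ω ∂μ, ∀ T, ∑ t ∈ Finset.range T, (η t ω * ‖g t ω‖) ^ 2 ≤ B := by
    filter_upwards [hg_le] with ω hω T
    refine le_trans (le_of_eq ?_) (mul_le_mul_of_nonneg_left
      (sum_div_rpow_one_add_le (q := fun t ↦ ‖g t ω‖ ^ 2) hβ (mul_pos two_pos hε)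
        (fun t ↦ sq_nonneg _) (fun t ↦ pow_le_pow_left₀ (norm_nonneg _) (hω t) 2) T)
      (sq_nonneg α))
    rw [Finset.mul_sum]
    refine Finset.sum_congr rfl fun t _ ↦ ?_
    have hbase : 0 ≤ β + ∑ i ∈ Finset.range t, ‖g i ω‖ ^ 2 := by positivity
    have hexp : (1 : ℝ) + 2 * ε = p * (2 : ℕ) := by simp only [p]; push_cast; ring
    rw [hη, hexp, Real.rpow_mul hbase, Real.rpow_natCast]
    ring
  obtain ⟨c, hc⟩ := hf_bdd
  have hinner_sum : ∀ᵐ ω ∂μ, ∀ T,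
      ∑ t ∈ Finset.range T, inner ℝ (η t ω • gradient f (x t ω)) (g t ω) ≤
        f x₁ - c + |M| * B := by
    filter_upwards [hstep_sum] with ω hω T
    have hdescent : ∀ t, inner ℝ (η t ω • gradient f (x t ω)) (g t ω) ≤
        (f (x t ω) - f (x (t + 1) ω)) + |M| * (η t ω * ‖g t ω‖) ^ 2 := fun t ↦ by
      have h := le_add_inner_gradient_of_gradient_lipschitz hM0 hf_diff hsmooth
        (x t ω) (x (t + 1) ω)
      have hdiff : x (t + 1) ω - x t ω = -(η t ω • g t ω) := by rw [hupd]; abel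
      rw [hdiff, inner_neg_right, norm_neg, norm_smul, Real.norm_of_nonneg (hη_pos t ω).le,
        real_inner_smul_right] at h
      rw [real_inner_smul_left]
      linarith
    refine (Finset.sum_le_sum fun t _ ↦ hdescent t).trans ?_
    rw [Finset.sum_add_distrib, Finset.sum_range_sub', ← Finset.mul_sum, hx0]
    have := hc (Set.mem_range_self (x T ω))
    have := mul_le_mul_of_nonneg_left (hω T) hM0
    linarith
  have hinner_int : ∀ t,
      Integrable (fun ω ↦ inner ℝ (η t ω • gradient f (x t ω)) (g t ω)) μ := fun t ↦
    (innerSL ℝ).integrable_of_bilin_of_bdd_left (H * |L|)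
      ((hY_meas t).mono (ℱ.le t)).aestronglyMeasurable (ae_of_all _ (hY_le t)) (hg_int t)
  have hsq : ∀ t ω, inner ℝ (η t ω • gradient f (x t ω)) (gradient f (x t ω)) =
      η t ω * ‖gradient f (x t ω)‖ ^ 2 := fun t ω ↦ by
    rw [real_inner_smul_left, real_inner_self_eq_norm_sq]
  have hsq_int : ∀ t, Integrable (fun ω ↦ η t ω * ‖gradient f (x t ω)‖ ^ 2) μ := fun t ↦ by
    have hgx : Integrable (fun ω ↦ gradient f (x t ω)) μ :=
      integrable_condExp.congr (hg_cond t)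
    simp_rw [← hsq]
    exact (innerSL ℝ).integrable_of_bilin_of_bdd_left (H * |L|)
      ((hY_meas t).mono (ℱ.le t)).aestronglyMeasurable (ae_of_all _ (hY_le t)) hgx
  have hsummable : ∀ᵐ ω ∂μ, Summable fun t ↦ η t ω * ‖gradient f (x t ω)‖ ^ 2 := by
    refine ae_summable_of_integral_sum_le (C := f x₁ - c + |M| * B) hsq_int
      (fun t ω ↦ mul_nonneg (hη_pos t ω).le (sq_nonneg _)) fun T ↦ ?_
    have heq : ∀ t, ∫ ω, η t ω * ‖gradient f (x t ω)‖ ^ 2 ∂μ =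
        ∫ ω, inner ℝ (η t ω • gradient f (x t ω)) (g t ω) ∂μ := fun t ↦ by
      simp_rw [integral_inner_eq_of_condExp_ae_eq (ℱ.le t) (hY_meas t) (hY_le t) (hg_int t)
        (hg_cond t), hsq]
    simp_rw [heq]
    rw [← integral_finsetSum _ fun t _ ↦ hinner_int t]
    refine (integral_mono_ae (integrable_finsetSum _ fun t _ ↦ hinner_int t)
      (integrable_const (f x₁ - c + |M| * B)) ?_).trans (by simp)
    filter_upwards [hinner_sum] with ω hω using hω T
  filter_upwards [hsummable, hstep_sum, hg_le] with ω hsum hstep hgω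
  refine tendsto_zero_of_summable_mul_sq (A := |L|) (K := |M| * G) (η := fun t ↦ η t ω)
    (w := fun t ↦ |M| * (η t ω * ‖g t ω‖)) (fun _ ↦ norm_nonneg _) (fun _ ↦ hgrad _)
    (fun t ↦ (hη_pos t ω).le) (fun t ↦ ?_) (fun t ↦ ?_) hsum ?_ ?_
  · refine (abs_norm_sub_norm_le _ _).trans ((hsmooth _ _).trans_eq ?_)
    rw [hupd, sub_sub_cancel_left, norm_neg, norm_smul, Real.norm_of_nonneg (hη_pos t ω).le]
  · have := mul_le_mul_of_nonneg_left (hgω t) (hη_pos t ω).le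
    calc |M| * (η t ω * ‖g t ω‖) ≤ |M| * (η t ω * G) := mul_le_mul_of_nonneg_left this hM0
      _ = |M| * G * η t ω := by ring
  · simp_rw [mul_pow |M|]
    exact (summable_of_sum_range_le (fun t ↦ sq_nonneg _) hstep).mul_left _
  · simp_rw [hη]
    exact not_summable_div_rpow_sum hα hβ (by positivity) (by simp only [p]; linarith)
      (fun t ↦ sq_nonneg _) (fun t ↦ pow_le_pow_left₀ (norm_nonneg _) (hgω t) 2)
end

section
/- Let f : ℝ^d → ℝ be M-smooth, L-Lipschitz, and bounded from below. Consider SGD iterates x_{t+1} = x_t − H_t g_t, where g_t = g(x_t, ξ_t) are stochastic gradients satisfying E_t[g_t] = ∇f(x_t) and bounded noise ‖g_t − ∇f(x_t)‖ ≤ S almost surely, and H_t is the diagonal matrix of coordinate-wise generalized AdaGrad stepsizes η_{t,j} = α / (β + Σ_{i=1}^{t−1} (g_i)_j²)^{1/2+ε} with α, β > 0 and ε ∈ (0, 1/2]. Then liminf_{t→∞} ‖∇f(x_t)‖² · t^{1/2−ε} = 0 almost surely. -/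
open MeasureTheory Filter Real

/-- A descent inequality for functions with Lipschitz gradient. -/
lemma le_add_inner_gradient_add_sq {E : Type*} [NormedAddCommGroup E] [InnerProductSpace ℝ E]
    [CompleteSpace E] {f : E → ℝ} {M : ℝ} (hM : 0 ≤ M) (hf : Differentiable ℝ f)
    (hM' : ∀ y z, ‖gradient f y - gradient f z‖ ≤ M * ‖y - z‖) (y z : E) :
    f z ≤ f y + inner ℝ (gradient f y) (z - y) + M * ‖z - y‖ ^ 2 := by
  obtain ⟨w, hw, h⟩ := domain_mvt (f := f) (f' := fderiv ℝ f) (s := Set.univ) (x := y) (y := z)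
    (fun u _ => (hf u).hasFDerivAt.hasFDerivWithinAt) convex_univ trivial trivial
  rw [← inner_gradient_left] at h
  have hwy : ‖w - y‖ ≤ ‖z - y‖ := by
    obtain ⟨θ, hθ, rfl⟩ := (segment_eq_image' ℝ y z ▸ hw : w ∈ _)
    simp only [add_sub_cancel_left, norm_smul, Real.norm_eq_abs, abs_of_nonneg hθ.1]
    exact mul_le_of_le_one_left (norm_nonneg _) hθ.2
  have key : inner ℝ (gradient f w - gradient f y) (z - y) ≤ M * ‖z - y‖ ^ 2 :=
    calc _ ≤ ‖gradient f w - gradient f y‖ * ‖z - y‖ := real_inner_le_norm _ _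
      _ ≤ (M * ‖z - y‖) * ‖z - y‖ := by gcongr; exact (hM' w y).trans (by gcongr)
      _ = _ := by ring
  rw [inner_sub_left] at key
  linarith

lemma norm_gradient_le_of_lipschitz_s3 {E : Type*} [NormedAddCommGroup E] [InnerProductSpace ℝ E]
    [CompleteSpace E] {f : E → ℝ} {L : ℝ} (hL : 0 ≤ L)
    (hf : ∀ y z, |f y - f z| ≤ L * ‖y - z‖) (y : E) : ‖gradient f y‖ ≤ L := by
  have h : LipschitzWith ⟨L, hL⟩ f := .of_dist_le_mul fun y z => by
    rw [Real.dist_eq, dist_eq_norm]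
    exact hf y z
  have := norm_fderiv_le_of_lipschitz ℝ h (x₀ := y)
  rwa [← toDual_gradient, LinearIsometryEquiv.norm_map] at this

lemma mul_rpow_neg_sub_one_le {q y z : ℝ} (hq : 0 ≤ q) (hy : 0 < y) (hz : 0 < z) :
    q * (z - y) * z ^ (-(1 + q)) ≤ y ^ (-q) - z ^ (-q) := by
  have h1 : 1 + q * (1 - y / z) ≤ (y / z) ^ (-q) := by
    rw [Real.rpow_def_of_pos (by positivity)]
    have h2 := Real.add_one_le_exp (Real.log (y / z) * -q)
    have h3 := Real.log_le_sub_one_of_pos (div_pos hy hz)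
    nlinarith
  rw [Real.div_rpow hy.le hz.le, le_div_iff₀ (by positivity)] at h1
  rw [neg_add, Real.rpow_add hz, Real.rpow_neg_one]
  have : q * (z - y) * (z⁻¹ * z ^ (-q)) = q * (1 - y / z) * z ^ (-q) := by field_simp
  rw [this]
  linarith

/-- Partial sums of a bounded nonnegative sequence, each term divided by a power larger than one of
the preceding partial sum, stay bounded. -/
lemma sum_div_rpow_sum_le {β K q : ℝ} (hβ : 0 < β) (hK : 0 ≤ K) (hq : 0 < q) {a : ℕ → ℝ}
    (ha : ∀ t, 0 ≤ a t) (haK : ∀ t, a t ≤ K) (T : ℕ) :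
    ∑ t ∈ Finset.range T, a t / (β + ∑ i ∈ Finset.range t, a i) ^ (1 + q) ≤
      (1 + K / β) ^ (1 + q) / q * β ^ (-q) := by
  set s : ℕ → ℝ := fun t => β + ∑ i ∈ Finset.range t, a i with hs
  have hsβ t : β ≤ s t := le_add_of_nonneg_right (Finset.sum_nonneg fun i _ => ha i)
  have hs0 t : 0 < s t := hβ.trans_le (hsβ t)
  have hsucc t : s (t + 1) = s t + a t := by simp [hs, Finset.sum_range_succ, add_assoc]
  have hratio t : s (t + 1) ≤ (1 + K / β) * s t := by
    rw [hsucc, add_mul, one_mul]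
    gcongr
    calc a t ≤ K := haK t
      _ = K / β * β := by field_simp
      _ ≤ _ := by gcongr; exact hsβ t
  set R := (1 + K / β) ^ (1 + q) / q
  have hterm t : a t / s t ^ (1 + q) ≤ R * (s t ^ (-q) - s (t + 1) ^ (-q)) := by
    have h1 := mul_rpow_neg_sub_one_le hq.le (hs0 t) (hs0 (t + 1))
    rw [Real.rpow_neg (hs0 _).le, hsucc t, add_sub_cancel_left, ← hsucc t] at h1
    have h2 : s (t + 1) ^ (1 + q) ≤ (1 + K / β) ^ (1 + q) * s t ^ (1 + q) := by
      rw [← Real.mul_rpow (by positivity) (hs0 t).le]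
      exact Real.rpow_le_rpow (hs0 _).le (hratio t) (by positivity)
    have h3 := Real.rpow_pos_of_pos (hs0 t) (1 + q)
    have h4 := Real.rpow_pos_of_pos (hs0 (t + 1)) (1 + q)
    calc a t / s t ^ (1 + q) ≤ R * (q * a t * (s (t + 1) ^ (1 + q))⁻¹) := by
          have : R * (q * a t * (s (t + 1) ^ (1 + q))⁻¹) =
              ((1 + K / β) ^ (1 + q) * a t) / s (t + 1) ^ (1 + q) := by
            simp only [R]; field_simp
          rw [this, div_le_div_iff₀ h3 h4]
          nlinarith [mul_le_mul_of_nonneg_left h2 (ha t)]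
      _ ≤ _ := by gcongr
  calc _ ≤ ∑ t ∈ Finset.range T, R * (s t ^ (-q) - s (t + 1) ^ (-q)) :=
        Finset.sum_le_sum fun t _ => hterm t
    _ = R * (s 0 ^ (-q) - s T ^ (-q)) := by rw [← Finset.mul_sum, Finset.sum_range_sub']
    _ ≤ R * β ^ (-q) := by
        have : s 0 = β := by simp [hs]
        rw [this]
        gcongr
        exact sub_le_self _ (Real.rpow_nonneg (hs0 T).le _)

lemma integral_mul_eq_integral_mul_condExp {Ω : Type*} {m m0 : MeasurableSpace Ω} {μ : Measure Ω}
    [IsFiniteMeasure μ] (hm : m ≤ m0) {h Y : Ω → ℝ} {C : ℝ} (hh : StronglyMeasurable[m] h)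
    (hC : ∀ ω, |h ω| ≤ C) (hY : Integrable Y μ) :
    ∫ ω, h ω * Y ω ∂μ = ∫ ω, h ω * (μ[Y | m]) ω ∂μ := by
  have hhY : Integrable (h * Y) μ :=
    hY.bdd_mul (hh.mono hm).aestronglyMeasurable (ae_of_all _ hC)
  calc _ = ∫ ω, (μ[h * Y | m]) ω ∂μ := (integral_condExp hm).symm
    _ = _ := integral_congr_ae (condExp_mul_of_stronglyMeasurable_left hh hhY hY)

/-- Nonnegative random variables whose partial sums have bounded expectation are almost surely
summable. -/
lemma ae_summable_of_sum_integral_le {Ω : Type*} {m0 : MeasurableSpace Ω} {μ : Measure Ω}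
    {A : ℕ → Ω → ℝ} {C : ℝ} (hA : ∀ t, Integrable (A t) μ) (hA0 : ∀ t ω, 0 ≤ A t ω)
    (hC : ∀ T, ∑ t ∈ Finset.range T, ∫ ω, A t ω ∂μ ≤ C) :
    ∀ᵐ ω ∂μ, Summable fun t => A t ω := by
  have hsum : ∑' t, ∫⁻ ω, ENNReal.ofReal (A t ω) ∂μ ≠ ⊤ := by
    refine ne_top_of_le_ne_top (ENNReal.ofReal_ne_top (r := C)) ?_
    rw [ENNReal.tsum_eq_iSup_nat]
    refine iSup_le fun T => ?_
    calc _ = ∑ t ∈ Finset.range T, ENNReal.ofReal (∫ ω, A t ω ∂μ) :=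
          Finset.sum_congr rfl fun t _ =>
            (ofReal_integral_eq_lintegral_ofReal (hA t) (ae_of_all _ (hA0 t))).symm
      _ = ENNReal.ofReal (∑ t ∈ Finset.range T, ∫ ω, A t ω ∂μ) :=
          (ENNReal.ofReal_sum_of_nonneg fun t _ => integral_nonneg (hA0 t)).symm
      _ ≤ _ := ENNReal.ofReal_le_ofReal (hC T)
  have hmeas t : AEMeasurable (fun ω => ENNReal.ofReal (A t ω)) μ :=
    (hA t).aestronglyMeasurable.aemeasurable.ennreal_ofReal
  rw [← lintegral_tsum hmeas] at hsum
  filter_upwards [ae_lt_top' (AEMeasurable.tsum hmeas) hsum] with ω hω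
  refine (ENNReal.summable_toReal hω.ne).congr fun t => ?_
  exact ENNReal.toReal_ofReal (hA0 t ω)

/-- A Lyapunov-type criterion: if `F` decreases by `P` up to summable errors `Q`, and `P` has the
same expectation as the nonnegative `A`, then `A` is almost surely summable. -/
lemma ae_summable_of_descent {Ω : Type*} {m0 : MeasurableSpace Ω} {μ : Measure Ω}
    [IsProbabilityMeasure μ] {F P Q A : ℕ → Ω → ℝ} {b C : ℝ}
    (hF : ∀ t, Integrable (F t) μ) (hP : ∀ t, Integrable (P t) μ) (hQ : ∀ t, Integrable (Q t) μ)
    (hA : ∀ t, Integrable (A t) μ) (hA0 : ∀ t ω, 0 ≤ A t ω) (hb : ∀ t ω, b ≤ F t ω)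
    (hPA : ∀ t, ∫ ω, P t ω ∂μ = ∫ ω, A t ω ∂μ)
    (hQC : ∀ T, ∀ᵐ ω ∂μ, ∑ t ∈ Finset.range T, Q t ω ≤ C)
    (hstep : ∀ t ω, F (t + 1) ω ≤ F t ω - P t ω + Q t ω) :
    ∀ᵐ ω ∂μ, Summable fun t => A t ω := by
  refine ae_summable_of_sum_integral_le (C := ∫ ω, F 0 ω ∂μ - b + C) hA hA0 fun T => ?_
  have h1 t : ∫ ω, A t ω ∂μ ≤ (∫ ω, F t ω ∂μ - ∫ ω, F (t + 1) ω ∂μ) + ∫ ω, Q t ω ∂μ := by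
    have h := integral_mono (hF (t + 1)) (((hF t).sub (hP t)).add (hQ t)) (hstep t)
    rw [integral_add' ((hF t).sub (hP t)) (hQ t), integral_sub' (hF t) (hP t), hPA] at h
    linarith
  have h2 : ∑ t ∈ Finset.range T, ∫ ω, Q t ω ∂μ ≤ C := by
    rw [← integral_finsetSum _ fun t _ => hQ t]
    simpa using integral_mono_ae (integrable_finsetSum _ fun t _ => hQ t) (integrable_const C)
      (hQC T)
  have h3 : b ≤ ∫ ω, F T ω ∂μ := by
    simpa using integral_mono (integrable_const b) (hF T) (hb T)
  have h4 := Finset.sum_le_sum fun t (_ : t ∈ Finset.range T) => h1 t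
  rw [Finset.sum_add_distrib, Finset.sum_range_sub'] at h4
  linarith

/-- A nonnegative sequence summable against the weights `(β + K t) ^ (-p)` satisfies
`liminf u t * t ^ (1 - p) = 0`. -/
lemma liminf_mul_rpow_eq_zero {u : ℕ → ℝ} {β K p : ℝ} (hβ : 0 < β) (hK : 0 ≤ K) (hp : 0 ≤ p)
    (hu : ∀ t, 0 ≤ u t) (hsum : Summable fun t : ℕ => u t / (β + K * t) ^ p) :
    liminf (fun t : ℕ => u t * (t : ℝ) ^ (1 - p)) atTop = 0 := by
  have hnonneg (t : ℕ) : 0 ≤ u t * (t : ℝ) ^ (1 - p) :=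
    mul_nonneg (hu t) (Real.rpow_nonneg t.cast_nonneg _)
  have hbdd : IsBoundedUnder (· ≥ ·) atTop fun t : ℕ => u t * (t : ℝ) ^ (1 - p) :=
    isBoundedUnder_of ⟨0, hnonneg⟩
  have hfreq (c : ℝ) (hc : 0 < c) : ∃ᶠ t : ℕ in atTop, u t * (t : ℝ) ^ (1 - p) ≤ c := by
    intro hev
    apply Real.not_summable_one_div_natCast
    have hsum' := hsum.mul_left ((β + K) ^ p / c)
    refine Summable.of_norm_bounded_eventually_nat hsum' ?_
    filter_upwards [hev, eventually_ge_atTop 1] with t ht ht1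
    have ht1 : (1 : ℝ) ≤ t := by exact_mod_cast ht1
    have ht0 : (0 : ℝ) < t := by linarith
    have htp := Real.rpow_pos_of_pos ht0 p
    have hden : (β + K * t) ^ p ≤ (β + K) ^ p * (t : ℝ) ^ p := by
      rw [← Real.mul_rpow (by positivity) ht0.le]
      exact Real.rpow_le_rpow (by positivity) (by nlinarith) hp
    rw [Real.rpow_sub ht0, Real.rpow_one, not_le] at ht
    rw [Real.norm_of_nonneg (by positivity)]
    have hu' : c / t ≤ u t / (t : ℝ) ^ p := by
      rw [div_le_iff₀ ht0]
      calc c ≤ _ := ht.le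
        _ = _ := by ring
    calc 1 / (t : ℝ) = c / t / c := by field_simp
      _ ≤ u t / (t : ℝ) ^ p / c := by gcongr
      _ = (β + K) ^ p / c * (u t / ((β + K) ^ p * (t : ℝ) ^ p)) := by
          have : 0 < (β + K) ^ p := by positivity
          field_simp
      _ ≤ _ := by
          have := hu t
          gcongr
  refine le_antisymm (le_of_forall_pos_le_add fun c hc => ?_) ?_
  · simpa using liminf_le_of_frequently_le (hfreq c hc) hbdd
  · refine le_liminf_of_le ?_ (Eventually.of_forall hnonneg)
    exact IsCoboundedUnder.of_frequently_le (hfreq 1 one_pos)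

/-- Almost sure `liminf` result for SGD with the
coordinate-wise generalized AdaGrad stepsizes (diagonal stepsize matrices), for an
`M`-smooth, `L`-Lipschitz function bounded from below, with unbiased stochastic
gradients whose noise has support bounded by `S`. -/
theorem sgd_coordinate_adagrad_liminf_zero_ae
    {d : ℕ} {Ω : Type*} {m0 : MeasurableSpace Ω} {μ : Measure Ω}
    [IsProbabilityMeasure μ] (ℱ : Filtration ℕ m0)
    (f : EuclideanSpace ℝ (Fin d) → ℝ) (M L S α β ε : ℝ)
    (hf_diff : Differentiable ℝ f)
    (hf_smooth : ∀ y z, ‖gradient f y - gradient f z‖ ≤ M * ‖y - z‖)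
    (hf_lip : ∀ y z, |f y - f z| ≤ L * ‖y - z‖)
    (hf_bdd : BddBelow (Set.range f))
    (hα : 0 < α) (hβ : 0 < β) (hε : 0 < ε) (hε' : ε ≤ 1 / 2)
    (x g : ℕ → Ω → EuclideanSpace ℝ (Fin d)) (η : ℕ → Fin d → Ω → ℝ)
    (x₁ : EuclideanSpace ℝ (Fin d))
    (hx0 : ∀ ω, x 0 ω = x₁)
    (hg_meas : ∀ t, StronglyMeasurable[ℱ (t + 1)] (g t))
    (hg_int : ∀ t, Integrable (g t) μ)
    (hg_cond : ∀ t, μ[g t | ℱ t] =ᵐ[μ] fun ω => gradient f (x t ω))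
    (hnoise : ∀ᵐ ω ∂μ, ∀ t, ‖g t ω - gradient f (x t ω)‖ ≤ S)
    (hη : ∀ t j ω, η t j ω =
      α / (β + ∑ i ∈ Finset.range t, (g i ω j) ^ 2) ^ ((1 : ℝ) / 2 + ε))
    (hupd : ∀ t ω (j : Fin d), x (t + 1) ω j = x t ω j - η t j ω * g t ω j) :
    ∀ᵐ ω ∂μ, Filter.liminf
      (fun t : ℕ => ‖gradient f (x t ω)‖ ^ 2 * (t : ℝ) ^ ((1 : ℝ) / 2 - ε)) atTop = 0 := by
  set p : ℝ := 1 / 2 + ε with hp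
  set G : ℝ := |L| + |S|
  set c : ℝ := α / β ^ p with hc
  have hc0 : 0 ≤ c := by positivity
  set E : Fin d → EuclideanSpace ℝ (Fin d) →L[ℝ] ℝ := fun j => EuclideanSpace.proj j
  have hcoord (v : EuclideanSpace ℝ (Fin d)) (j : Fin d) : |v j| ≤ ‖v‖ := PiLp.norm_apply_le v j
  have hlip y z : |f y - f z| ≤ |L| * ‖y - z‖ :=
    (hf_lip y z).trans (by gcongr; exact le_abs_self L)
  have hgrad y : ‖gradient f y‖ ≤ |L| := norm_gradient_le_of_lipschitz_s3 (abs_nonneg L) hlip y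
  have hsmooth y z : ‖gradient f y - gradient f z‖ ≤ |M| * ‖y - z‖ :=
    (hf_smooth y z).trans (by gcongr; exact le_abs_self M)
  have hgrad_cont : Continuous (gradient f) :=
    (LipschitzWith.of_dist_le_mul (K := ⟨|M|, abs_nonneg M⟩) fun y z => by
      rw [dist_eq_norm, dist_eq_norm]
      exact hsmooth y z).continuous
  have hs t j ω : β ≤ β + ∑ i ∈ Finset.range t, (g i ω j) ^ 2 :=
    le_add_of_nonneg_right (Finset.sum_nonneg fun i _ => sq_nonneg _)
  have hη0 t j ω : 0 ≤ η t j ω := by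
    have := hβ.trans_le (hs t j ω)
    rw [hη]; positivity
  have hηc t j ω : η t j ω ≤ c := by
    rw [hη, hc]
    have := hs t j ω
    gcongr
  have hg_bound : ∀ᵐ ω ∂μ, ∀ t, ‖g t ω‖ ≤ G := by
    filter_upwards [hnoise] with ω hω t
    calc ‖g t ω‖ = ‖gradient f (x t ω) + (g t ω - gradient f (x t ω))‖ := by
          rw [add_sub_cancel]
      _ ≤ ‖gradient f (x t ω)‖ + ‖g t ω - gradient f (x t ω)‖ := norm_add_le _ _
      _ ≤ G := add_le_add (hgrad _) ((hω t).trans (le_abs_self S))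
  have hg_sq : ∀ᵐ ω ∂μ, ∀ t j, (g t ω j) ^ 2 ≤ G ^ 2 := by
    filter_upwards [hg_bound] with ω hω t j
    rw [← sq_abs]
    exact pow_le_pow_left₀ (abs_nonneg _) ((hcoord _ j).trans (hω t)) 2
  have hgj_meas t j : StronglyMeasurable[ℱ (t + 1)] fun ω => g t ω j :=
    (E j).continuous.comp_stronglyMeasurable (hg_meas t)
  have hgj_int t j : Integrable (fun ω => g t ω j) μ := (E j).integrable_comp (hg_int t)
  have hη_meas t j : StronglyMeasurable[ℱ t] (η t j) := by
    have hsum : StronglyMeasurable[ℱ t] fun ω => ∑ i ∈ Finset.range t, (g i ω j) ^ 2 :=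
      Finset.stronglyMeasurable_fun_sum _ fun i hi =>
        ((hgj_meas i j).mono (ℱ.mono (Finset.mem_range.1 hi))).pow 2
    have : η t j = fun ω => α / (β + ∑ i ∈ Finset.range t, (g i ω j) ^ 2) ^ p := funext (hη t j)
    rw [this]
    exact (measurable_const.div
      ((measurable_const.add hsum.measurable).pow_const p)).stronglyMeasurable
  have hx_succ t ω : x (t + 1) ω =
      x t ω - ∑ j, (η t j ω * g t ω j) • EuclideanSpace.single j (1 : ℝ) := by
    ext i
    simp [hupd, Finset.sum_apply, Pi.single_apply]
  have hx_meas t : StronglyMeasurable[ℱ t] (x t) := by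
    induction t with
    | zero => rw [funext hx0]; exact stronglyMeasurable_const
    | succ t ih =>
      have hle : ℱ t ≤ ℱ (t + 1) := ℱ.mono t.le_succ
      rw [funext (hx_succ t)]
      exact (ih.mono hle).sub (Finset.stronglyMeasurable_fun_sum _ fun j _ =>
        (((hη_meas t j).mono hle).mul (hgj_meas t j)).smul_const _)
  have hgrad_meas t j : StronglyMeasurable[ℱ t] fun ω => gradient f (x t ω) j :=
    ((E j).continuous.comp hgrad_cont).comp_stronglyMeasurable (hx_meas t)
  set h : ℕ → Fin d → Ω → ℝ := fun t j ω => η t j ω * gradient f (x t ω) j with hh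
  have hh_meas t j : StronglyMeasurable[ℱ t] (h t j) := (hη_meas t j).mul (hgrad_meas t j)
  have hh_bound t j ω : |h t j ω| ≤ c * |L| := by
    rw [abs_mul, abs_of_nonneg (hη0 t j ω)]
    exact mul_le_mul (hηc t j ω) ((hcoord _ j).trans (hgrad _)) (abs_nonneg _) hc0
  have hmul_int t j {Y : Ω → ℝ} (hY : Integrable Y μ) :
      Integrable (fun ω => h t j ω * Y ω) μ :=
    hY.bdd_mul ((hh_meas t j).mono (ℱ.le t)).aestronglyMeasurable (ae_of_all _ (hh_bound t j))
  have hgrad_int t j : Integrable (fun ω => gradient f (x t ω) j) μ :=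
    .of_bound ((hgrad_meas t j).mono (ℱ.le t)).aestronglyMeasurable |L|
      (ae_of_all _ fun ω => (hcoord _ j).trans (hgrad _))
  have hF_int t : Integrable (fun ω => f (x t ω)) μ := by
    induction t with
    | zero => simp only [hx0]; exact integrable_const _
    | succ t ih =>
      have hnorm_int := ((hg_int t).norm.const_mul (d * c)).const_mul |L|
      refine (ih.abs.add hnorm_int).mono'
        ((hf_diff.continuous.comp_stronglyMeasurable (hx_meas (t + 1))).mono
          (ℱ.le _)).aestronglyMeasurable (ae_of_all _ fun ω => ?_)
      have h1 : ‖x (t + 1) ω - x t ω‖ ≤ d * c * ‖g t ω‖ := by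
        rw [hx_succ, sub_sub_cancel_left, norm_neg]
        refine (norm_sum_le_of_le (f := fun j => (η t j ω * g t ω j) •
          EuclideanSpace.single j (1 : ℝ)) Finset.univ (fun j _ => ?_)).trans_eq
          (b := ∑ _j : Fin d, c * ‖g t ω‖) (by simp [mul_assoc])
        rw [norm_smul, PiLp.norm_single, norm_one, mul_one, norm_mul,
          Real.norm_of_nonneg (hη0 t j ω)]
        exact mul_le_mul (hηc t j ω) (hcoord _ j) (norm_nonneg _) hc0
      have h2 := hlip (x (t + 1) ω) (x t ω)
      calc |f (x (t + 1) ω)| = |f (x t ω) + (f (x (t + 1) ω) - f (x t ω))| := by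
            rw [add_sub_cancel]
        _ ≤ |f (x t ω)| + |f (x (t + 1) ω) - f (x t ω)| := abs_add_le _ _
        _ ≤ |f (x t ω)| + |L| * (d * c * ‖g t ω‖) := by
            gcongr
            exact h2.trans (by gcongr)
  have hηg_int t j : Integrable (fun ω => (η t j ω * g t ω j) ^ 2) μ := by
    refine .of_bound ((((hη_meas t j).mono (ℱ.le t)).mul
      ((hgj_meas t j).mono (ℱ.le _))).pow 2).aestronglyMeasurable (c ^ 2 * G ^ 2) ?_
    filter_upwards [hg_sq] with ω hω
    rw [Real.norm_of_nonneg (sq_nonneg _), mul_pow]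
    exact mul_le_mul (pow_le_pow_left₀ (hη0 t j ω) (hηc t j ω) 2) (hω t j) (sq_nonneg _)
      (sq_nonneg _)
  obtain ⟨b, hb⟩ := hf_bdd
  have hsummable : ∀ᵐ ω ∂μ, Summable fun t => ∑ j, h t j ω * gradient f (x t ω) j := by
    refine ae_summable_of_descent (F := fun t ω => f (x t ω))
      (P := fun t ω => ∑ j, h t j ω * g t ω j)
      (Q := fun t ω => |M| * ∑ j, (η t j ω * g t ω j) ^ 2) (b := b)
      (C := |M| * ∑ _j : Fin d,
        α ^ 2 * ((1 + G ^ 2 / β) ^ (1 + 2 * ε) / (2 * ε) * β ^ (-(2 * ε))))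
      hF_int (fun t => integrable_finsetSum _ fun j _ => hmul_int t j (hgj_int t j))
      (fun t => (integrable_finsetSum _ fun j _ => hηg_int t j).const_mul _)
      (fun t => integrable_finsetSum _ fun j _ => hmul_int t j (hgrad_int t j))
      (fun t ω => Finset.sum_nonneg fun j _ => ?_) (fun t ω => hb ⟨_, rfl⟩) (fun t => ?_)
      (fun T => ?_) (fun t ω => ?_)
    · simp only [hh, mul_assoc]
      exact mul_nonneg (hη0 t j ω) (mul_self_nonneg _)
    · rw [integral_finsetSum _ fun j _ => hmul_int t j (hgj_int t j),
        integral_finsetSum _ fun j _ => hmul_int t j (hgrad_int t j)]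
      refine Finset.sum_congr rfl fun j _ => ?_
      rw [integral_mul_eq_integral_mul_condExp (ℱ.le t) (hh_meas t j) (hh_bound t j) (hgj_int t j)]
      refine integral_congr_ae ?_
      filter_upwards [hg_cond t, (E j).comp_condExp_comm (hg_int t) (m := ℱ t)] with ω h1 h2
      have h3 : (μ[fun ω => g t ω j | ℱ t]) ω = gradient f (x t ω) j := by
        rw [← h1]
        exact h2.symm
      rw [h3]
    · filter_upwards [hg_sq] with ω hω
      rw [← Finset.mul_sum, Finset.sum_comm]
      refine mul_le_mul_of_nonneg_left (Finset.sum_le_sum fun j _ => ?_) (abs_nonneg M)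
      refine le_trans (le_of_eq ?_) (mul_le_mul_of_nonneg_left
        (sum_div_rpow_sum_le hβ (sq_nonneg G) (q := 2 * ε) (by positivity)
          (fun t => sq_nonneg (g t ω j)) (fun t => hω t j) T) (sq_nonneg α))
      rw [Finset.mul_sum]
      refine Finset.sum_congr rfl fun t _ => ?_
      have hpow : (1 + 2 * ε : ℝ) = p * (2 : ℕ) := by rw [hp]; push_cast; ring
      rw [hη, hpow, Real.rpow_mul (hβ.le.trans (hs t j ω)), Real.rpow_natCast]
      ring
    · have h1 := le_add_inner_gradient_add_sq (abs_nonneg M) hf_diff hsmooth (x t ω) (x (t + 1) ω)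
      have h2 : inner ℝ (gradient f (x t ω)) (x (t + 1) ω - x t ω) =
          -∑ j, h t j ω * g t ω j := by
        rw [PiLp.inner_apply, ← Finset.sum_neg_distrib]
        refine Finset.sum_congr rfl fun j _ => ?_
        simp only [PiLp.sub_apply, hupd, hh, RCLike.inner_apply, conj_trivial]
        ring
      have h3 : ‖x (t + 1) ω - x t ω‖ ^ 2 = ∑ j, (η t j ω * g t ω j) ^ 2 := by
        rw [EuclideanSpace.norm_sq_eq]
        refine Finset.sum_congr rfl fun j _ => ?_
        simp only [PiLp.sub_apply, hupd, Real.norm_eq_abs, sq_abs]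
        ring
      rw [h2, h3] at h1
      exact h1
  filter_upwards [hsummable, hg_sq] with ω hω hgω
  have hexp : (1 : ℝ) / 2 - ε = 1 - p := by rw [hp]; ring
  rw [hexp]
  refine liminf_mul_rpow_eq_zero hβ (sq_nonneg G) (by positivity) (fun t => sq_nonneg _) ?_
  refine Summable.of_nonneg_of_le (fun t => by positivity) (fun t => ?_) (hω.mul_left α⁻¹)
  rw [EuclideanSpace.norm_sq_eq, Finset.sum_div, Finset.mul_sum]
  refine Finset.sum_le_sum fun j _ => ?_
  have hsum : ∑ i ∈ Finset.range t, (g i ω j) ^ 2 ≤ G ^ 2 * t := by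
    refine (Finset.sum_le_card_nsmul _ _ (G ^ 2) fun i _ => hgω i j).trans_eq ?_
    simp [mul_comm]
  have hspos := hβ.trans_le (hs t j ω)
  calc ‖gradient f (x t ω) j‖ ^ 2 / (β + G ^ 2 * t) ^ p
      ≤ ‖gradient f (x t ω) j‖ ^ 2 / (β + ∑ i ∈ Finset.range t, (g i ω j) ^ 2) ^ p := by
        gcongr
    _ = _ := by
        simp only [hh, hη, Real.norm_eq_abs, sq_abs]
        field_simp
end

section
/- Let (g_t)_{t≥1} be any sequence of vectors in ℝ^d satisfying ‖g_t‖² ≤ 2(L² + S²) for all t, and let η_t = α / (β + Σ_{i=1}^{t−1} ‖g_i‖²)^{1/2+ε} with α, β > 0 and ε ∈ (0, 1/2]. Then Σ_{t=1}^∞ η_t² ‖g_t‖² ≤ α²/(2ε β^{2ε}) + 2(α²/β^{1+2ε})(L² + S²) < ∞. -/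
/-- Right-endpoint comparison of `(y - x) y^{-(1+q)}` with `∫ u in x..y, u^{-(1+q)}`. -/
theorem sub_mul_rpow_neg_one_add_le {x y q : ℝ} (hx : 0 < x) (hy : 0 < y) (hq : 0 < q) :
    (y - x) * y ^ (-(1 + q)) ≤ (x ^ (-q) - y ^ (-q)) / q := by
  have hlog : Real.log (x / y) ≤ x / y - 1 := Real.log_le_sub_one_of_pos (div_pos hx hy)
  have hexp : 1 + q * (1 - x / y) ≤ (x / y) ^ (-q) := by
    rw [Real.rpow_def_of_pos (div_pos hx hy)]
    have h := Real.add_one_le_exp (Real.log (x / y) * -q)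
    nlinarith
  have hxq : x ^ (-q) = (x / y) ^ (-q) * y ^ (-q) := by
    rw [← Real.mul_rpow (div_pos hx hy).le hy.le, div_mul_cancel₀ _ hy.ne']
  have hyq : y ^ (-(1 + q)) = y ^ (-q) / y := by
    rw [← Real.rpow_sub_one hy.ne']
    congr 1
    ring
  have hpos : 0 < y ^ (-q) := Real.rpow_pos_of_pos hy _
  rw [le_div_iff₀ hq, hxq, hyq]
  calc (y - x) * (y ^ (-q) / y) * q = (1 + q * (1 - x / y)) * y ^ (-q) - y ^ (-q) := by
        field_simp
        ring
    _ ≤ _ := by gcongr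

/-- The partial sums of `a t / (β + ∑ i < t, a i)^(1+q)` are bounded by telescoping quantities. -/
theorem sum_mul_rpow_partial_sum_le {a : ℕ → ℝ} {β q M : ℝ} (ha : ∀ t, 0 ≤ a t)
    (haM : ∀ t, a t ≤ M) (hβ : 0 < β) (hq : 0 < q) (n : ℕ) :
    ∑ t ∈ Finset.range n, a t * (β + ∑ i ∈ Finset.range t, a i) ^ (-(1 + q)) ≤
      (β ^ (-q) - (β + ∑ i ∈ Finset.range n, a i) ^ (-q)) / q +
        M * (β ^ (-(1 + q)) - (β + ∑ i ∈ Finset.range n, a i) ^ (-(1 + q))) := by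
  induction n with
  | zero => simp
  | succ n ih =>
    rw [Finset.sum_range_succ, Finset.sum_range_succ, ← add_assoc]
    set s := β + ∑ i ∈ Finset.range n, a i
    have hs : 0 < s := add_pos_of_pos_of_nonneg hβ (Finset.sum_nonneg fun i _ => ha i)
    have hs' : 0 < s + a n := add_pos_of_pos_of_nonneg hs (ha n)
    have hint := sub_mul_rpow_neg_one_add_le hs hs' hq
    have hanti : (s + a n) ^ (-(1 + q)) ≤ s ^ (-(1 + q)) :=
      Real.rpow_le_rpow_of_nonpos hs (by linarith [ha n]) (by linarith)
    have hM := mul_le_mul_of_nonneg_right (haM n) (sub_nonneg.2 hanti)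
    rw [add_sub_cancel_left, sub_div] at hint
    rw [sub_div] at ih ⊢
    linarith


/-- Pathwise bound: if `‖gₜ‖² ≤ 2(L² + S²)` for all `t` and
`ηₜ = α / (β + Σ_{i<t} ‖gᵢ‖²)^{1/2+ε}` with `α, β > 0`, `ε ∈ (0, 1/2]`, then
`Σₜ ηₜ² ‖gₜ‖²` is finite and bounded by `α²/(2εβ^{2ε}) + 2(α²/β^{1+2ε})(L² + S²)`. -/
theorem adagrad_sum_sq_stepsize_grad_le
    {d : ℕ} (g : ℕ → EuclideanSpace ℝ (Fin d)) (L S α β ε : ℝ)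
    (hα : 0 < α) (hβ : 0 < β) (hε : 0 < ε) (hε' : ε ≤ 1 / 2)
    (hg : ∀ t, ‖g t‖ ^ 2 ≤ 2 * (L ^ 2 + S ^ 2))
    (η : ℕ → ℝ)
    (hη : ∀ t, η t = α / (β + ∑ i ∈ Finset.range t, ‖g i‖ ^ 2) ^ ((1 : ℝ) / 2 + ε)) :
    Summable (fun t => η t ^ 2 * ‖g t‖ ^ 2) ∧
      ∑' t, η t ^ 2 * ‖g t‖ ^ 2
        ≤ α ^ 2 / (2 * ε * β ^ (2 * ε)) + 2 * (α ^ 2 / β ^ (1 + 2 * ε)) * (L ^ 2 + S ^ 2) := by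
  have ha : ∀ t, 0 ≤ ‖g t‖ ^ 2 := fun t => sq_nonneg _
  have hs : ∀ t, 0 < β + ∑ i ∈ Finset.range t, ‖g i‖ ^ 2 := fun t =>
    add_pos_of_pos_of_nonneg hβ (Finset.sum_nonneg fun i _ => ha i)
  have hterm : ∀ t, η t ^ 2 * ‖g t‖ ^ 2 = α ^ 2 *
      (‖g t‖ ^ 2 * (β + ∑ i ∈ Finset.range t, ‖g i‖ ^ 2) ^ (-(1 + 2 * ε))) := fun t => by
    rw [hη, div_pow, ← Real.rpow_mul_natCast (hs t).le, Real.rpow_neg (hs t).le]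
    have : ((1 : ℝ) / 2 + ε) * (2 : ℕ) = 1 + 2 * ε := by
      push_cast
      ring
    rw [this]
    ring
  have hbound : ∀ n, ∑ t ∈ Finset.range n, η t ^ 2 * ‖g t‖ ^ 2 ≤
      α ^ 2 / (2 * ε * β ^ (2 * ε)) + 2 * (α ^ 2 / β ^ (1 + 2 * ε)) * (L ^ 2 + S ^ 2) := by
    intro n
    have hq : 0 < 2 * ε := by linarith
    have h := sum_mul_rpow_partial_sum_le ha hg hβ hq n
    have hle : (β ^ (-(2 * ε)) - (β + ∑ i ∈ Finset.range n, ‖g i‖ ^ 2) ^ (-(2 * ε))) / (2 * ε) +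
        2 * (L ^ 2 + S ^ 2) *
          (β ^ (-(1 + 2 * ε)) - (β + ∑ i ∈ Finset.range n, ‖g i‖ ^ 2) ^ (-(1 + 2 * ε))) ≤
        β ^ (-(2 * ε)) / (2 * ε) + 2 * (L ^ 2 + S ^ 2) * β ^ (-(1 + 2 * ε)) := by
      gcongr
      · exact sub_le_self _ (Real.rpow_nonneg (hs n).le _)
      · exact sub_le_self _ (Real.rpow_nonneg (hs n).le _)
    simp_rw [hterm]
    rw [← Finset.mul_sum]
    refine (mul_le_mul_of_nonneg_left (h.trans hle) (sq_nonneg α)).trans_eq ?_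
    rw [Real.rpow_neg hβ.le, Real.rpow_neg hβ.le]
    field_simp
  have hnonneg : ∀ t, 0 ≤ η t ^ 2 * ‖g t‖ ^ 2 := fun t => by positivity
  exact ⟨summable_of_sum_range_le hnonneg hbound, Real.tsum_le_of_sum_range_le hnonneg hbound⟩
end
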